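/- arXiv:0904.4600 — 2 statements merged into one kernel-verified Lean document; each statement's English description precedes it below -/
import Mathlib

section
/- Let k ≥ 1 be an integer and let r and t be rationals with 2 ≤ r < (2k+1)/k ≤ t ≤ 4k/(2k−1). Then s(K_r, K_t) = 2k/(2k+1). -/
open scoped Classical

noncomputable section

/-- The circular complete graph `K_{p/q}`: vertices `v_0, …, v_{p-1}` with an edge
`v_i v_j` whenever `q ≤ |i - j| ≤ p - q`. -/
def circK (p q : ℕ) : SimpleGraph (Fin p) :=
  SimpleGraph.fromRel (fun i j =>
    q ≤ max i.val j.val - min i.val j.val ∧ max i.val j.val - min i.val j.val ≤ p - q)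

/-- The complete graph on two vertices. -/
def K2 : SimpleGraph (Fin 2) := ⊤

/-- The cycle graph on `n` vertices. -/
def cycleG (n : ℕ) : SimpleGraph (Fin n) :=
  SimpleGraph.fromRel (fun i j => (i.val + 1) % n = j.val)

/-- The total weight of the edges of `G` carried to edges of `H` by the vertex map `f`. -/
def cutWeight {α β : Type} [Fintype α] (G : SimpleGraph α) (H : SimpleGraph β)
    (w : Sym2 α → ℚ) (f : α → β) : ℝ :=
  ∑ e ∈ Finset.univ.filter (fun e : Sym2 α => e ∈ G.edgeSet ∧ Sym2.map f e ∈ H.edgeSet), (w e : ℝ)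

/-- `mc_H(G,w)`: the maximum over all vertex maps `f : V(G) → V(H)` of the total weight
of the edges of `G` mapped to edges of `H`. -/
def mcMax {α β : Type} [Fintype α] (H : SimpleGraph β) (G : SimpleGraph α)
    (w : Sym2 α → ℚ) : ℝ :=
  ⨆ f : α → β, cutWeight G H w f

/-- `s(M,N)`: the infimum over all finite simple graphs `G` with at least one edge and all
positive rational edge-weight functions `w` of `mc_M(G,w)/mc_N(G,w)`. -/
def sVal {α β : Type} (M : SimpleGraph α) (N : SimpleGraph β) : ℝ :=
  sInf { x : ℝ | ∃ (n : ℕ) (G : SimpleGraph (Fin n)) (w : Sym2 (Fin n) → ℚ),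
    G.edgeSet.Nonempty ∧ (∀ e ∈ G.edgeSet, 0 < w e) ∧
    x = mcMax M G w / mcMax N G w }

/-- For a rational `r = p/q` in lowest terms, the circular complete graph `K_r`. -/
def circKQ (r : ℚ) : SimpleGraph (Fin r.num.toNat) := circK r.num.toNat r.den

theorem aux_circ {p q : ℕ} (hq : 0 < q) (i j : Fin p) : (circK p q).Adj i j ↔
    ((q ≤ j.val - i.val ∧ j.val - i.val ≤ p - q) ∨ (q ≤ i.val - j.val ∧ i.val - j.val ≤ p - q)) := by
  have h := @Fin.ext_iff p i j
  have hi := i.2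
  have hj := j.2
  simp only [circK, SimpleGraph.fromRel_adj, ne_eq, h]
  constructor
  · rintro ⟨h1, h2 | h2⟩ <;> omega
  · intro h2
    refine ⟨?_, Or.inl ?_⟩ <;> omega

theorem aux_cut_le {α β : Type} [Fintype α] [Finite β] (G : SimpleGraph α) (H : SimpleGraph β)
    (w : Sym2 α → ℚ) (f : α → β) : cutWeight G H w f ≤ mcMax H G w :=
  le_ciSup (f := fun f => cutWeight G H w f) (Set.finite_range _).bddAbove f

theorem aux_cut_eq {α β : Type} [Fintype α] (G : SimpleGraph α) (H : SimpleGraph β)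
    (w : Sym2 α → ℚ) (f : α → β) : cutWeight G H w f =
      ∑ e ∈ Finset.univ.filter (fun e : Sym2 α => e ∈ G.edgeSet),
        if Sym2.map f e ∈ H.edgeSet then (w e : ℝ) else 0 := by
  unfold cutWeight
  rw [← Finset.sum_filter, Finset.filter_filter]

theorem aux_lower {α β γ : Type} [Fintype α] [Finite β] [Finite γ] [Nonempty γ]
    (G : SimpleGraph α) (M : SimpleGraph β) (N : SimpleGraph γ) (w : Sym2 α → ℚ)
    (hw : ∀ e ∈ G.edgeSet, 0 < w e) (n : ℕ) (g : Fin (n+1) → γ → β)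
    (hg : ∀ x y, N.Adj x y → ∀ c c', ¬ M.Adj (g c x) (g c y) → ¬ M.Adj (g c' x) (g c' y) → c = c') :
    (n : ℝ) * mcMax N G w ≤ ((n : ℝ) + 1) * mcMax M G w := by
  have key : ∀ f : α → γ, (n : ℝ) * cutWeight G N w f ≤ ((n : ℝ) + 1) * mcMax M G w := by
    intro f
    have h1 : ∑ c : Fin (n+1), cutWeight G M w (g c ∘ f) ≤ ((n : ℝ) + 1) * mcMax M G w := by
      calc _ ≤ ∑ c : Fin (n+1), mcMax M G w := Finset.sum_le_sum fun c _ => aux_cut_le _ _ _ _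
        _ = _ := by simp
    refine le_trans ?_ h1
    simp only [aux_cut_eq]
    rw [Finset.sum_comm, Finset.mul_sum]
    refine Finset.sum_le_sum fun e he => ?_
    have he' : e ∈ G.edgeSet := by simpa using he
    have hwe : (0 : ℝ) < w e := by exact_mod_cast hw e he'
    clear he he'
    induction e with | _ x y
    simp only [Sym2.map_mk, SimpleGraph.mem_edgeSet, Function.comp]
    split_ifs with hN
    · rw [← Finset.sum_filter, Finset.sum_const, nsmul_eq_mul]
      refine mul_le_mul_of_nonneg_right ?_ hwe.le
      have h2 := Finset.card_filter_add_card_filter_not (s := (Finset.univ : Finset (Fin (n+1))))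
        (fun c => M.Adj (g c (f x)) (g c (f y)))
      have h3 : (Finset.univ.filter (fun c => ¬ M.Adj (g c (f x)) (g c (f y)))).card ≤ 1 := by
        rw [Finset.card_le_one]
        intro a ha b hb
        simp only [Finset.mem_filter, Finset.mem_univ, true_and] at ha hb
        exact hg _ _ hN _ _ ha hb
      rw [Finset.card_univ, Fintype.card_fin] at h2
      norm_cast
      omega
    · rw [mul_zero]
      exact Finset.sum_nonneg fun c _ => by split_ifs <;> linarith
  unfold mcMax at *
  obtain ⟨f, hf⟩ := exists_eq_ciSup_of_finite (f := fun f : α → γ => cutWeight G N w f)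
  rw [← hf]
  exact key f

theorem aux_pos {α β : Type} [Fintype α] [Finite β]
    (G : SimpleGraph α) (M : SimpleGraph β) (w : Sym2 α → ℚ)
    (hw : ∀ e ∈ G.edgeSet, 0 < w e) (hG : G.edgeSet.Nonempty) (a b : β) (hab : M.Adj a b) :
    0 < mcMax M G w := by
  obtain ⟨e, he⟩ := hG
  induction e with | _ x y
  have hxy : G.Adj x y := he
  refine lt_of_lt_of_le ?_ (aux_cut_le G M w (fun z => if z = x then a else b))
  unfold cutWeight
  refine Finset.sum_pos ?_ ⟨s(x, y), ?_⟩
  · intro e he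
    simp only [Finset.mem_filter, Finset.mem_univ, true_and] at he
    exact_mod_cast hw e he.1
  · simp [hxy, hxy.ne', hab]

def auxHalf (k : ℕ) (c a : ℕ) : Prop :=
  if c < 2 * k then c ≤ a ∧ a < c + 2 * k else a % 2 = 0

theorem aux_half (k a b c d : ℕ) (hk : 1 ≤ k) (hc : c < 2*k+1) (hd : d < 2*k+1)
    (hb : b < 4*k) (h1 : a + (2*k-1) ≤ b) (h2 : b ≤ a + (2*k+1))
    (hc' : auxHalf k c a ↔ auxHalf k c b) (hd' : auxHalf k d a ↔ auxHalf k d b) : c = d := by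
  unfold auxHalf at *
  split_ifs at * <;> omega

theorem aux_div (p q p' q' i j : ℕ) (hq : 0 < q) (hpq : p * q' ≤ p' * q) (hi : i < p) (hj : j < p)
    (h1 : q ≤ j - i) (h2 : j - i ≤ p - q) :
    i * q' / q + q' ≤ j * q' / q ∧ j * q' / q + q' ≤ i * q' / q + p' := by
  constructor
  · rw [← Nat.add_mul_div_right _ _ hq]
    apply Nat.div_le_div_right
    have : i + q ≤ j := by omega
    nlinarith
  · rw [← Nat.add_mul_div_right _ _ hq, ← Nat.add_mul_div_right _ _ hq]
    apply Nat.div_le_div_right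
    have : j + q ≤ i + p := by omega
    nlinarith

theorem aux_lt (p q p' q' i : ℕ) (hq : 0 < q) (hpq : p * q' ≤ p' * q) (hi : i < p) (hq' : 0 < q') :
    i * q' / q < p' := by
  rw [Nat.div_lt_iff_lt_mul hq]
  nlinarith

theorem aux_nohom (k p q : ℕ) (hp : p * k < (2*k+1) * q)
    (hq : 0 < q) (f : Fin (2*k+1) → Fin p) (h : ∀ i, (circK p q).Adj (f i) (f (i+1))) : False := by
  have h1 : ∀ i, ∃ c : ℤ, (q:ℤ) ≤ (f (i+1)).val - (f i).val + p * c ∧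
      ((f (i+1)).val : ℤ) - (f i).val + p * c ≤ p - q := by
    intro i
    have h2 := (f (i+1)).2
    have h3 := (f i).2
    rcases (aux_circ hq _ _).1 (h i) with h | h
    · exact ⟨0, by omega⟩
    · exact ⟨1, by omega⟩
  choose c hc using h1
  have hs : ∑ i, (((f (i+1)).val : ℤ) - (f i).val) = 0 := by
    rw [Finset.sum_sub_distrib, sub_eq_zero]
    exact Equiv.sum_comp (Equiv.addRight (1 : Fin (2*k+1))) (fun i => ((f i).val : ℤ))
  have hA := Finset.sum_le_sum (s := Finset.univ) (fun i _ => (hc i).1)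
  have hB := Finset.sum_le_sum (s := Finset.univ) (fun i _ => (hc i).2)
  rw [Finset.sum_add_distrib, hs, ← Finset.mul_sum] at hA hB
  simp only [Finset.sum_const, Finset.card_univ, Fintype.card_fin, nsmul_eq_mul, zero_add] at hA hB
  push_cast at hA hB
  set C := ∑ i, c i
  zify at hp
  have hp0 : (0:ℤ) < p := by
    have := (f 0).2
    omega
  have h4 : (k:ℤ) < C := by nlinarith
  have h5 : C < k + 1 := by nlinarith
  omega

theorem aux_hom (k p q : ℕ) (hk : 1 ≤ k) (hp : (2*k+1) * q ≤ p * k) (hq : 0 < q) :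
    ∃ f : Fin (2*k+1) → Fin p, ∀ i, (circK p q).Adj (f i) (f (i+1)) := by
  have hm : ∀ i : ℕ, (i * k) % (2*k+1) < 2*k+1 := fun i => Nat.mod_lt _ (by omega)
  refine ⟨fun i => ⟨((i.val * k) % (2*k+1)) * q / k, aux_lt _ _ _ _ _ hk hp (hm _) hq⟩, ?_⟩
  intro i
  rw [aux_circ hq]
  simp only
  have hv : ((i+1 : Fin (2*k+1)).val * k) % (2*k+1) = ((i.val * k) % (2*k+1) + k) % (2*k+1) := by
    rw [Fin.val_add, Nat.mod_mul_mod, Nat.mod_add_mod, Fin.val_one', Nat.mod_eq_of_lt (a := 1) (by omega),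
      add_mul, one_mul]
  rw [hv]
  have ha := hm i.val
  generalize (i.val * k) % (2*k+1) = a at *
  have hlt := aux_lt _ _ _ _ a hk hp ha hq
  have hqp : q ≤ p := by nlinarith
  by_cases h : a + k < 2*k+1
  · rw [Nat.mod_eq_of_lt h]
    have := aux_div _ _ _ _ a (a+k) hk hp ha h (by omega) (by omega)
    omega
  · have : (a + k) % (2*k+1) = a - (k+1) := by
      rw [Nat.mod_eq_sub_mod (by omega), Nat.mod_eq_of_lt (by omega)]
      omega
    rw [this]
    have := aux_div _ _ _ _ (a-(k+1)) a hk hp (by omega) ha (by omega) (by omega)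
    omega

theorem aux_upper (k p q p' q' : ℕ) (hk : 1 ≤ k) (hp : p * k < (2*k+1) * q) (hq : 0 < q)
    (hp0 : 0 < p) (hp' : (2*k+1) * q' ≤ p' * k) (hq' : 0 < q') :
    ∃ (n : ℕ) (G : SimpleGraph (Fin n)) (w : Sym2 (Fin n) → ℚ),
    G.edgeSet.Nonempty ∧ (∀ e ∈ G.edgeSet, 0 < w e) ∧
    mcMax (circK p q) G w / mcMax (circK p' q') G w ≤ (2*(k:ℝ)) / (2*(k:ℝ)+1) := by
  have hne : ∀ i : Fin (2*k+1), i ≠ i + 1 := by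
    intro i h
    have h2 : (1 : Fin (2*k+1)) = 0 := by simpa using h.symm
    have := congrArg Fin.val h2
    rw [Fin.val_one', Nat.mod_eq_of_lt (by omega)] at this
    simp at this
  let G : SimpleGraph (Fin (2*k+1)) := SimpleGraph.fromRel (fun i j => i + 1 = j)
  have hadj : ∀ i, G.Adj i (i+1) := fun i => by simp [G, SimpleGraph.fromRel_adj, hne i]
  have hedge : ∀ e ∈ G.edgeSet, ∃ i, e = s(i, i+1) := by
    intro e he
    induction e with | _ x y
    have he : G.Adj x y := he
    rw [SimpleGraph.fromRel_adj] at he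
    rcases he with ⟨_, h | h⟩
    · exact ⟨x, by rw [h]⟩
    · exact ⟨y, by rw [h, Sym2.eq_swap]⟩
  refine ⟨2*k+1, G, fun _ => 1, ⟨s(0, 0+1), hadj 0⟩, fun _ _ => one_pos, ?_⟩
  set E := (Finset.univ.filter (fun e : Sym2 (Fin (2*k+1)) => e ∈ G.edgeSet)) with hE
  have hE1 : E.card ≤ 2*k+1 := by
    have : E ⊆ Finset.univ.image (fun i : Fin (2*k+1) => s(i, i+1)) := by
      intro e he
      obtain ⟨i, hi⟩ := hedge e (by simpa [hE] using he)
      simp [hi]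
    calc _ ≤ _ := Finset.card_le_card this
      _ ≤ _ := Finset.card_image_le
      _ = _ := by simp
  have hE0 : 0 < E.card := Finset.card_pos.2 ⟨s(0, 0+1), by simpa [hE] using hadj 0⟩
  have hN : (E.card : ℝ) ≤ mcMax (circK p' q') G (fun _ => 1) := by
    obtain ⟨f, hf⟩ := aux_hom k p' q' hk hp' hq'
    refine le_trans (le_of_eq ?_) (aux_cut_le _ _ _ f)
    rw [aux_cut_eq, Finset.card_eq_sum_ones]
    push_cast
    refine Finset.sum_congr (by ext; simp [hE]) fun e he => ?_
    obtain ⟨i, rfl⟩ := hedge e (by simpa [hE] using he)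
    simp [hf i]
  have hM : mcMax (circK p q) G (fun _ => 1) ≤ (E.card : ℝ) - 1 := by
    haveI : Nonempty (Fin p) := ⟨⟨0, hp0⟩⟩
    refine ciSup_le fun f => ?_
    unfold cutWeight
    have : (Finset.univ.filter (fun e : Sym2 (Fin (2*k+1)) => e ∈ G.edgeSet ∧
        Sym2.map f e ∈ (circK p q).edgeSet)).card < E.card := by
      apply Finset.card_lt_card
      rw [Finset.ssubset_iff_subset_ne]
      refine ⟨fun e he => ?_, fun heq => ?_⟩
      · simp only [Finset.mem_filter, Finset.mem_univ, true_and, hE] at he ⊢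
        exact he.1
      · refine aux_nohom k p q hp hq f fun i => ?_
        have : s(i, i+1) ∈ E := by simpa [hE] using hadj i
        rw [← heq] at this
        simp only [Finset.mem_filter] at this
        exact this.2.2
    have h2 : ((Finset.univ.filter (fun e : Sym2 (Fin (2*k+1)) => e ∈ G.edgeSet ∧
        Sym2.map f e ∈ (circK p q).edgeSet)).card : ℝ) + 1 ≤ E.card := by exact_mod_cast this
    simp only [Rat.cast_one, Finset.sum_const, nsmul_eq_mul, mul_one]
    refine le_sub_iff_add_le.2 (le_trans (le_of_eq ?_) h2)
    congr!
  have hE0' : (1:ℝ) ≤ E.card := by exact_mod_cast hE0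
  have hE1' : (E.card : ℝ) ≤ 2*k+1 := by exact_mod_cast hE1
  rw [div_le_div_iff₀ (by linarith) (by positivity)]
  have hk0 : (0:ℝ) ≤ k := by positivity
  nlinarith

theorem aux_cuts (k p q p' q' : ℕ) (hk : 1 ≤ k) (hp : 2 * q ≤ p) (hq : 0 < q)
    (hp' : p' * (2*k-1) ≤ 4*k * q') (hq' : 0 < q') :
    ∃ g : Fin (2*k+1) → Fin p' → Fin p, ∀ x y, (circK p' q').Adj x y → ∀ c c',
      ¬ (circK p q).Adj (g c x) (g c y) → ¬ (circK p q).Adj (g c' x) (g c' y) → c = c' := by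
  let g : Fin (2*k+1) → Fin p' → Fin p := fun c x =>
    if auxHalf k c.val (x.val * (2*k-1) / q') then ⟨0, by omega⟩ else ⟨q, by omega⟩
  have hg : ∀ c x y, ¬ (circK p q).Adj (g c x) (g c y) →
      (auxHalf k c.val (x.val * (2*k-1) / q') ↔ auxHalf k c.val (y.val * (2*k-1) / q')) := by
    intro c x y h
    by_contra h2
    apply h
    rw [aux_circ hq]
    by_cases h3 : auxHalf k c.val (x.val * (2*k-1) / q') <;>
    by_cases h4 : auxHalf k c.val (y.val * (2*k-1) / q') <;>
      simp [g, h3, h4] at h2 ⊢ <;> omega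
  refine ⟨g, ?_⟩
  have main : ∀ x y : Fin p', (q' ≤ y.val - x.val ∧ y.val - x.val ≤ p' - q') → ∀ c c',
      ¬ (circK p q).Adj (g c x) (g c y) → ¬ (circK p q).Adj (g c' x) (g c' y) → c = c' := by
    intro x y hxy c c' h1 h2
    have hd := aux_div _ _ _ _ x.val y.val hq' hp' x.2 y.2 hxy.1 hxy.2
    have hl := aux_lt _ _ _ _ y.val hq' hp' y.2 (by omega)
    exact Fin.ext (aux_half k _ _ _ _ hk c.2 c'.2 hl (by omega) (by omega) (hg c x y h1) (hg c' x y h2))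
  intro x y hxy c c' h1 h2
  rcases (aux_circ hq' _ _).1 hxy with h | h
  · exact main x y h c c' h1 h2
  · exact main y x h c c' (fun h => h1 h.symm) (fun h => h2 h.symm)

theorem aux_main (k p q p' q' : ℕ) (hk : 1 ≤ k) (hp2 : 2 * q ≤ p) (hp : p * k < (2*k+1) * q)
    (hq : 0 < q) (hp' : (2*k+1) * q' ≤ p' * k) (hq' : 0 < q') (hp4 : p' * (2*k-1) ≤ 4*k * q') :
    sVal (circK p q) (circK p' q') = (2*(k:ℝ)) / (2*(k:ℝ)+1) := by
  have hp'q : 2 * q' ≤ p' := by nlinarith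
  haveI : Nonempty (Fin p') := ⟨⟨0, by omega⟩⟩
  have lower : ∀ x ∈ { x : ℝ | ∃ (n : ℕ) (G : SimpleGraph (Fin n)) (w : Sym2 (Fin n) → ℚ),
    G.edgeSet.Nonempty ∧ (∀ e ∈ G.edgeSet, 0 < w e) ∧
    x = mcMax (circK p q) G w / mcMax (circK p' q') G w }, (2*(k:ℝ)) / (2*(k:ℝ)+1) ≤ x := by
    rintro x ⟨n, G, w, hG, hw, rfl⟩
    have hpos : 0 < mcMax (circK p' q') G w :=
      aux_pos G _ w hw hG ⟨0, by omega⟩ ⟨q', by omega⟩ (by rw [aux_circ hq']; simp only; omega)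
    obtain ⟨g, hg⟩ := aux_cuts k p q p' q' hk hp2 hq hp4 hq'
    have h := aux_lower G (circK p q) (circK p' q') w hw (2*k) g hg
    push_cast at h
    rw [div_le_div_iff₀ (by positivity) hpos]
    linarith
  obtain ⟨n, G, w, hG, hw, hle⟩ := aux_upper k p q p' q' hk hp hq (by omega) hp' hq'
  unfold sVal
  apply le_antisymm
  · exact le_trans (csInf_le ⟨_, lower⟩ ⟨n, G, w, hG, hw, rfl⟩) hle
  · exact le_csInf ⟨_, n, G, w, hG, hw, rfl⟩ lower

theorem stmt1 (k : ℕ) (hk : 1 ≤ k) (r t : ℚ)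
    (hr : 2 ≤ r) (hrt : r < (2*(k:ℚ)+1)/(k:ℚ))
    (ht1 : (2*(k:ℚ)+1)/(k:ℚ) ≤ t) (ht2 : t ≤ (4*(k:ℚ))/(2*(k:ℚ)-1)) :
    sVal (circKQ r) (circKQ t) = (2*(k:ℝ)) / (2*(k:ℝ)+1) := by
  have hkQ : (1:ℚ) ≤ k := by exact_mod_cast hk
  have aux : ∀ u : ℚ, 2 ≤ u → u = (u.num.toNat : ℚ) / u.den := by
    intro u hu
    have h1 : 0 ≤ u.num := Rat.num_nonneg.2 (by linarith)
    have h2 : ((u.num.toNat : ℤ) : ℚ) = u.num := by rw [Int.toNat_of_nonneg h1]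
    rw [Int.cast_natCast] at h2
    rw [h2]
    exact (Rat.num_div_den u).symm
  have ht2' : (2:ℚ) ≤ t := by linarith
  have er := aux r hr
  have et := aux t ht2'
  unfold circKQ
  have hq := r.den_pos
  have hq' := t.den_pos
  generalize r.num.toNat = p at *
  generalize r.den = q at *
  generalize t.num.toNat = p' at *
  generalize t.den = q' at *
  subst er et
  have hqQ : (0:ℚ) < q := by exact_mod_cast hq
  have hqQ' : (0:ℚ) < q' := by exact_mod_cast hq'
  rw [le_div_iff₀ hqQ] at hr
  rw [div_lt_div_iff₀ hqQ (by linarith)] at hrt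
  rw [div_le_div_iff₀ (by linarith) hqQ'] at ht1
  rw [div_le_div_iff₀ hqQ' (by linarith)] at ht2
  refine aux_main k p q p' q' hk (by exact_mod_cast hr) (by exact_mod_cast hrt) hq
    (by exact_mod_cast ht1) hq' ?_
  have : ((2*k-1 : ℕ) : ℚ) = 2*k-1 := by
    rw [Nat.cast_sub (by omega)]; push_cast; ring
  rw [← this] at ht2
  exact_mod_cast ht2
end
end

section
/- For every integer k ≥ 1, s(K_2, K_{(8k+6)/(4k+1)}) = (8k²+6k+2)/(8k²+10k+3). -/
open scoped Classical

noncomputable section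

lemma cntShift (p a : ℕ) (P : ℕ → Prop) [DecidablePred P] :
    ((Finset.range p).filter (fun t => P ((a + t) % p))).card ≤
      ((Finset.range p).filter P).card := by
  apply Finset.card_le_card_of_injOn (fun t => (a + t) % p)
  · intro t ht
    simp only [Finset.coe_filter, Finset.mem_range, Set.mem_ofPred_eq] at ht ⊢
    exact ⟨Nat.mod_lt _ (by omega), ht.2⟩
  · intro t ht t' ht' h
    simp only [Finset.coe_filter, Finset.mem_range, Set.mem_ofPred_eq] at ht ht'
    have h1 : a + t ≡ a + t' [MOD p] := h
    have h2 := Nat.ModEq.add_left_cancel' a h1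
    exact Nat.ModEq.eq_of_lt_of_lt h2 ht.1 ht'.1

/-- first cut -/
def cA (k x : ℕ) : Fin 2 := if x < 4*k+3 then 0 else 1
/-- second cut -/
def cB (k x : ℕ) : Fin 2 := if (x % 2 = 0 ↔ x < 2*k+2) then 0 else 1

lemma cA_eq (k x y : ℕ) : cA k x = cA k y ↔ (x < 4*k+3 ↔ y < 4*k+3) := by
  unfold cA; split_ifs <;> simp <;> omega

lemma cB_eq (k x y : ℕ) : cB k x = cB k y ↔
    ((x % 2 = 0 ↔ x < 2*k+2) ↔ (y % 2 = 0 ↔ y < 2*k+2)) := by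
  unfold cB; split_ifs <;> simp_all

lemma modcase (x d p : ℕ) (hx : x < p) (hd : d < p) :
    (x + d < p ∧ (x+d) % p = x + d) ∨ (p ≤ x + d ∧ (x+d) % p = x + d - p) := by
  by_cases h : x + d < p
  · exact Or.inl ⟨h, Nat.mod_eq_of_lt h⟩
  · refine Or.inr ⟨by omega, ?_⟩
    rw [Nat.mod_eq_sub_mod (by omega), Nat.mod_eq_of_lt (by omega)]

lemma cA1 (k : ℕ) : ((Finset.range (8*k+6)).filter
    (fun x => cA k x = cA k ((x + (4*k+1)) % (8*k+6)))).card ≤ 4 := by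
  calc _ ≤ (Finset.Ico 0 2 ∪ Finset.Ico (4*k+3) (4*k+5)).card := by
        apply Finset.card_le_card
        intro x hx
        simp only [Finset.mem_filter, Finset.mem_range, cA_eq] at hx
        simp only [Finset.mem_union, Finset.mem_Ico]
        rcases modcase x (4*k+1) (8*k+6) hx.1 (by omega) with h | h <;> omega
    _ ≤ _ := (Finset.card_union_le _ _).trans (by simp only [Nat.card_Ico]; omega)

lemma cA2 (k : ℕ) : ((Finset.range (8*k+6)).filter
    (fun x => cA k x = cA k ((x + (4*k+2)) % (8*k+6)))).card ≤ 2 := by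
  calc _ ≤ (Finset.Ico 0 1 ∪ Finset.Ico (4*k+3) (4*k+4)).card := by
        apply Finset.card_le_card
        intro x hx
        simp only [Finset.mem_filter, Finset.mem_range, cA_eq] at hx
        simp only [Finset.mem_union, Finset.mem_Ico]
        rcases modcase x (4*k+2) (8*k+6) hx.1 (by omega) with h | h <;> omega
    _ ≤ _ := (Finset.card_union_le _ _).trans (by simp only [Nat.card_Ico]; omega)

lemma cA3 (k : ℕ) : ((Finset.range (8*k+6)).filter
    (fun x => cA k x = cA k ((x + (4*k+3)) % (8*k+6)))).card ≤ 0 := by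
  calc _ ≤ (Finset.Ico 0 0).card := by
        apply Finset.card_le_card
        intro x hx
        simp only [Finset.mem_filter, Finset.mem_range, cA_eq] at hx
        rcases modcase x (4*k+3) (8*k+6) hx.1 (by omega) with h | h <;> omega
    _ ≤ _ := by simp

lemma cB1 (k : ℕ) : ((Finset.range (8*k+6)).filter
    (fun x => cB k x = cB k ((x + 1) % (8*k+6)))).card ≤ 2 := by
  calc _ ≤ (Finset.Ico (2*k+1) (2*k+2) ∪ Finset.Ico (8*k+5) (8*k+6)).card := by
        apply Finset.card_le_card
        intro x hx
        simp only [Finset.mem_filter, Finset.mem_range, cB_eq] at hx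
        simp only [Finset.mem_union, Finset.mem_Ico]
        rcases modcase x 1 (8*k+6) hx.1 (by omega) with h | h <;> omega
    _ ≤ _ := (Finset.card_union_le _ _).trans (by simp only [Nat.card_Ico]; omega)

lemma cB2 (k : ℕ) : ((Finset.range (8*k+6)).filter
    (fun x => cB k x = cB k ((x + (2*k+2)) % (8*k+6)))).card ≤ 4*k+2 := by
  calc _ ≤ (Finset.Ico (2*k+2) (6*k+4)).card := by
        apply Finset.card_le_card
        intro x hx
        simp only [Finset.mem_filter, Finset.mem_range, cB_eq] at hx
        simp only [Finset.mem_Ico]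
        rcases modcase x (2*k+2) (8*k+6) hx.1 (by omega) with h | h <;> omega
    _ ≤ _ := by simp only [Nat.card_Ico]; omega

lemma cB3 (k : ℕ) : ((Finset.range (8*k+6)).filter
    (fun x => cB k x = cB k ((x + (4*k+3)) % (8*k+6)))).card ≤ 4*k+4 := by
  calc _ ≤ (Finset.Ico 0 (2*k+2) ∪ Finset.Ico (4*k+3) (6*k+5)).card := by
        apply Finset.card_le_card
        intro x hx
        simp only [Finset.mem_filter, Finset.mem_range, cB_eq] at hx
        simp only [Finset.mem_union, Finset.mem_Ico]
        rcases modcase x (4*k+3) (8*k+6) hx.1 (by omega) with h | h <;> omega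
    _ ≤ _ := (Finset.card_union_le _ _).trans (by simp only [Nat.card_Ico]; omega)

/-- translated cuts -/
def tA (k t : ℕ) (i : Fin (8*k+6)) : Fin 2 := cA k ((i.val + t) % (8*k+6))
/-- translated cuts -/
def tB (k t : ℕ) (i : Fin (8*k+6)) : Fin 2 := cB k (((2*k+1)*i.val + t) % (8*k+6))

lemma shiftA (k d : ℕ) (i j : Fin (8*k+6)) (h : j.val = (i.val + d) % (8*k+6)) :
    ((Finset.range (8*k+6)).filter (fun t => tA k t i = tA k t j)).card ≤
    ((Finset.range (8*k+6)).filter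
    (fun x => cA k x = cA k ((x + d) % (8*k+6)))).card := by
  refine le_trans (le_of_eq ?_) (cntShift (8*k+6) i.val (fun x => cA k x = cA k ((x + d) % (8*k+6))))
  congr 1
  apply Finset.filter_congr
  intro t _
  unfold tA
  rw [h]
  have : ((i.val + d) % (8*k+6) + t) % (8*k+6) = ((i.val + t) % (8*k+6) + d) % (8*k+6) := by
    rw [Nat.mod_add_mod, Nat.mod_add_mod]; congr 1; ring
  rw [this]

lemma shiftB (k d d' : ℕ) (i j : Fin (8*k+6)) (h : j.val = (i.val + d) % (8*k+6))
    (hd : (2*k+1)*d ≡ d' [MOD (8*k+6)]) :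
    ((Finset.range (8*k+6)).filter (fun t => tB k t i = tB k t j)).card ≤
    ((Finset.range (8*k+6)).filter
    (fun x => cB k x = cB k ((x + d') % (8*k+6)))).card := by
  refine le_trans (le_of_eq ?_) (cntShift (8*k+6) ((2*k+1)*i.val) (fun x => cB k x = cB k ((x + d') % (8*k+6))))
  congr 1
  apply Finset.filter_congr
  intro t _
  unfold tB
  have : ((2*k+1)*j.val + t) % (8*k+6) = (((2*k+1)*i.val + t) % (8*k+6) + d') % (8*k+6) := by
    rw [Nat.mod_add_mod]
    have h1 : (2*k+1)*j.val ≡ (2*k+1)*(i.val+d) [MOD (8*k+6)] := by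
      rw [h]; exact (Nat.mod_modEq _ _).mul_left _
    have h2 : (2*k+1)*j.val ≡ (2*k+1)*i.val+d' [MOD (8*k+6)] := by
      rw [mul_add] at h1
      exact h1.trans (hd.add_left _)
    have h3 := h2.add_right t
    rw [show (2*k+1)*i.val + t + d' = (2*k+1)*i.val+d' + t by ring]
    exact h3
  rw [this]

lemma circ_cases (k : ℕ) (i j : Fin (8*k+6)) (h : (circK (8*k+6) (4*k+1)).Adj i j) :
    ∃ d, (d = 4*k+1 ∨ d = 4*k+2 ∨ d = 4*k+3) ∧
      (j.val = (i.val + d) % (8*k+6) ∨ i.val = (j.val + d) % (8*k+6)) := by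
  have key : ∀ a b : Fin (8*k+6), a.val ≤ b.val → 4*k+1 ≤ b.val - a.val →
      b.val - a.val ≤ 4*k+5 → ∃ d, (d = 4*k+1 ∨ d = 4*k+2 ∨ d = 4*k+3) ∧
      (b.val = (a.val + d) % (8*k+6) ∨ a.val = (b.val + d) % (8*k+6)) := by
    intro a b h0 h1 h2
    have ha := a.isLt
    have hb := b.isLt
    by_cases h3 : b.val - a.val ≤ 4*k+3
    · refine ⟨b.val - a.val, by omega, Or.inl ?_⟩
      rcases modcase a.val (b.val - a.val) (8*k+6) ha (by omega) with h | h <;> omega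
    · refine ⟨8*k+6 - (b.val - a.val), by omega, Or.inr ?_⟩
      rcases modcase b.val (8*k+6 - (b.val - a.val)) (8*k+6) hb (by omega) with h | h <;> omega
  simp only [circK, SimpleGraph.fromRel_adj] at h
  rcases le_total i.val j.val with hij | hij
  · exact key i j hij (by omega) (by omega)
  · obtain ⟨d, hd, h'⟩ := key j i hij (by omega) (by omega)
    exact ⟨d, hd, h'.symm⟩

lemma viol_dir (k : ℕ) (hk : 1 ≤ k) (i j : Fin (8*k+6)) (d : ℕ)
    (hd : d = 4*k+1 ∨ d = 4*k+2 ∨ d = 4*k+3) (h : j.val = (i.val + d) % (8*k+6)) :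
    2*k * ((Finset.range (8*k+6)).filter (fun t => tA k t i = tA k t j)).card +
    ((Finset.range (8*k+6)).filter (fun t => tB k t i = tB k t j)).card ≤ 8*k+2 := by
  have hm : ∀ a b : ℕ, a = b + (8*k+6)*k → a ≡ b [MOD (8*k+6)] := by
    intro a b h; rw [h]; exact Nat.add_mul_mod_self_left _ _ _
  rcases hd with rfl | rfl | rfl
  · have h1 := (shiftA k _ i j h).trans (cA1 k)
    have h2 := (shiftB k _ 1 i j h (hm _ _ (by ring))).trans (cB1 k)
    nlinarith [Nat.mul_le_mul_left (2*k) h1]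
  · have h1 := (shiftA k _ i j h).trans (cA2 k)
    have h2 := (shiftB k _ (2*k+2) i j h (hm _ _ (by ring))).trans (cB2 k)
    nlinarith [Nat.mul_le_mul_left (2*k) h1]
  · have h1 := (shiftA k _ i j h).trans (cA3 k)
    have h2 := (shiftB k _ (4*k+3) i j h (hm _ _ (by ring))).trans (cB3 k)
    nlinarith [Nat.mul_le_mul_left (2*k) h1]

lemma viol (k : ℕ) (hk : 1 ≤ k) (i j : Fin (8*k+6)) (h : (circK (8*k+6) (4*k+1)).Adj i j) :
    2*k * ((Finset.range (8*k+6)).filter (fun t => tA k t i = tA k t j)).card +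
    ((Finset.range (8*k+6)).filter (fun t => tB k t i = tB k t j)).card ≤ 8*k+2 := by
  obtain ⟨d, hd, h | h⟩ := circ_cases k i j h
  · exact viol_dir k hk i j d hd h
  · have := viol_dir k hk j i d hd h
    simpa only [eq_comm] using this

lemma cw_eq {α β : Type} [Fintype α] (G : SimpleGraph α) (H : SimpleGraph β)
    (w : Sym2 α → ℚ) (f : α → β) : cutWeight G H w f =
    ∑ e ∈ Finset.univ.filter (fun e : Sym2 α => e ∈ G.edgeSet),
      (if Sym2.map f e ∈ H.edgeSet then (1:ℝ) else 0) * (w e : ℝ) := by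
  unfold cutWeight
  rw [← Finset.filter_filter, Finset.sum_filter]
  apply Finset.sum_congr rfl
  intro e _
  split_ifs <;> simp

lemma cw_le_mc {α β : Type} [Fintype α] [Fintype β] (G : SimpleGraph α) (H : SimpleGraph β)
    (w : Sym2 α → ℚ) (f : α → β) : cutWeight G H w f ≤ mcMax H G w :=
  le_ciSup (f := fun f => cutWeight G H w f) (Set.finite_range _).bddAbove f

lemma sep_sum (k : ℕ) (hk : 1 ≤ k) (e : Sym2 (Fin (8*k+6)))
    (he : e ∈ (circK (8*k+6) (4*k+1)).edgeSet) :
    (16*(k:ℝ)^2+12*k+4) ≤ ∑ t ∈ Finset.range (8*k+6),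
      (2*(k:ℝ) * (if Sym2.map (tA k t) e ∈ K2.edgeSet then (1:ℝ) else 0) +
        (if Sym2.map (tB k t) e ∈ K2.edgeSet then (1:ℝ) else 0)) := by
  induction e using Sym2.ind with
  | _ i j =>
  rw [SimpleGraph.mem_edgeSet] at he
  have hv := viol k hk i j he
  simp only [Sym2.map_mk, SimpleGraph.mem_edgeSet, K2, SimpleGraph.top_adj]
  have gen : ∀ (F : ℕ → Prop) [DecidablePred F], ∑ t ∈ Finset.range (8*k+6), (if ¬ F t then (1:ℝ) else 0) =
      (8*k+6) - (((Finset.range (8*k+6)).filter F).card : ℝ) := by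
    intro F _
    have := Finset.card_filter_add_card_filter_not (s := Finset.range (8*k+6)) F
    rw [Finset.sum_boole]
    rw [Finset.card_range] at this
    have h2 : ((8*k+6 : ℕ) : ℝ) = 8*k+6 := by push_cast; ring
    have h3 := congrArg (Nat.cast (R := ℝ)) this
    push_cast at h3
    linarith
  rw [Finset.sum_add_distrib, ← Finset.mul_sum]
  simp only [ne_eq]
  rw [gen (fun t => tA k t i = tA k t j), gen (fun t => tB k t i = tB k t j)]
  have hv' : 2*(k:ℝ) * (((Finset.range (8*k+6)).filter (fun t => tA k t i = tA k t j)).card : ℝ) +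
    (((Finset.range (8*k+6)).filter (fun t => tB k t i = tB k t j)).card : ℝ) ≤ 8*k+2 := by
    exact_mod_cast hv
  nlinarith

lemma lower (k : ℕ) (hk : 1 ≤ k) (n : ℕ) (G : SimpleGraph (Fin n)) (w : Sym2 (Fin n) → ℚ)
    (hw : ∀ e ∈ G.edgeSet, 0 < w e) (f : Fin n → Fin (8*k+6)) :
    (16*(k:ℝ)^2+12*k+4) * cutWeight G (circK (8*k+6) (4*k+1)) w f ≤
      (8*k+6) * (2*k+1) * mcMax K2 G w := by
  calc _ ≤ ∑ t ∈ Finset.range (8*k+6), (2*(k:ℝ) * cutWeight G K2 w (tA k t ∘ f) +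
            cutWeight G K2 w (tB k t ∘ f)) := by
        simp only [cw_eq, Finset.mul_sum, ← Finset.sum_add_distrib]
        rw [Finset.sum_comm]
        apply Finset.sum_le_sum
        intro e he
        have hwe : (0:ℝ) ≤ w e := by
          exact_mod_cast (hw e (by simpa using he)).le
        simp only [← mul_assoc, ← add_mul, ← Finset.sum_mul]
        apply mul_le_mul_of_nonneg_right _ hwe
        split_ifs with h
        · have := sep_sum k hk _ h
          simp only [Sym2.map_map] at this
          simpa using this
        · rw [mul_zero]
          exact Finset.sum_nonneg (fun t _ => by positivity)
    _ ≤ ∑ t ∈ Finset.range (8*k+6), (2*(k:ℝ) * mcMax K2 G w + mcMax K2 G w) := by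
        apply Finset.sum_le_sum
        intro t _
        have h1 := cw_le_mc G K2 w (tA k t ∘ f)
        have h2 := cw_le_mc G K2 w (tB k t ∘ f)
        have : (0:ℝ) ≤ 2*k := by positivity
        nlinarith [mul_le_mul_of_nonneg_left h1 this]
    _ = _ := by
        rw [Finset.sum_const, Finset.card_range, nsmul_eq_mul]; push_cast; ring

/-! upper bound -/

lemma odd_cycle (k a : ℕ) (F : ℕ → Fin 2) (hF : ∀ j, F (j + (8*k+6)) = F j) :
    ∃ x, x < 8*k+6 ∧ x % 2 = a % 2 ∧ F x = F (x + (2*k+2)) := by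
  have hmod : ∀ j, F (j % (8*k+6)) = F j := fun j =>
    Function.Periodic.map_mod_nat (f := F) hF j
  by_contra hcon
  push Not at hcon
  have h1 : ∀ r, F (a + r*(2*k+2)) ≠ F (a + (r+1)*(2*k+2)) := by
    intro r
    have := hcon ((a + r*(2*k+2)) % (8*k+6)) (Nat.mod_lt _ (by omega)) (by
      rw [Nat.mod_mod_of_dvd _ (by omega : 2 ∣ 8*k+6)]
      have : a + r*(2*k+2) = a + 2*(r*(k+1)) := by ring
      rw [this]; omega)
    rw [hmod] at this
    have h2 : F ((a + r*(2*k+2)) % (8*k+6) + (2*k+2)) = F (a + (r+1)*(2*k+2)) := by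
      rw [← hmod, Nat.mod_add_mod, hmod]; congr 1; ring
    rwa [h2] at this
  have h2 : ∀ r, F (a + 2*r*(2*k+2)) = F a := by
    intro r
    induction r with
    | zero => simp
    | succ r ih =>
      have e1 := h1 (2*r)
      have e2 := h1 (2*r+1)
      rw [show 2*r+1+1 = 2*(r+1) by ring] at e2
      rw [ih] at e1
      generalize F (a + (2*r+1)*(2*k+2)) = y at *
      generalize F (a + 2*(r+1)*(2*k+2)) = z at *
      generalize F a = u at *
      omega
  have e1 := h1 (2*(2*k+1))
  rw [h2] at e1
  apply e1
  have : a + (2*(2*k+1)+1)*(2*k+2) = a + (k+1)*(8*k+6) := by ring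
  rw [this, ← hmod (a + (k+1)*(8*k+6)), Nat.add_mul_mod_self_right, hmod]

lemma comb (k : ℕ) (F : ℕ → Fin 2) (hF : ∀ j, F (j + (8*k+6)) = F j) :
    8*k+2 ≤ 2*k * ((Finset.range (8*k+6)).filter (fun j => F j = F (j+1))).card +
      ((Finset.range (8*k+6)).filter (fun j => F j = F (j+(2*k+2)))).card := by
  have hmod : ∀ j, F (j % (8*k+6)) = F j := fun j =>
    Function.Periodic.map_mod_nat (f := F) hF j
  set Va := (Finset.range (8*k+6)).filter (fun j => F j = F (j+1)) with hVa
  set Vb := (Finset.range (8*k+6)).filter (fun j => F j = F (j+(2*k+2))) with hVb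
  have heven : Even Va.card := by
    have h1 : ((Va.card : ℕ) : ZMod 2) = 0 := by
      rw [hVa, ← Finset.sum_boole]
      have : ∀ j, (if F j = F (j+1) then (1:ZMod 2) else 0) =
          (((F j).val : ℕ) : ZMod 2) + (((F (j+1)).val : ℕ) : ZMod 2) + 1 := by
        intro j
        generalize F j = x
        generalize F (j+1) = y
        fin_cases x <;> fin_cases y <;> simp <;> decide
      simp only [this]
      rw [Finset.sum_add_distrib, Finset.sum_add_distrib]
      have hs : ∑ j ∈ Finset.range (8*k+6), (((F (j+1)).val : ℕ) : ZMod 2) =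
          ∑ j ∈ Finset.range (8*k+6), (((F j).val : ℕ) : ZMod 2) := by
        have a1 := Finset.sum_range_succ (fun j => (((F j).val : ℕ) : ZMod 2)) (8*k+6)
        have a2 := Finset.sum_range_succ' (fun j => (((F j).val : ℕ) : ZMod 2)) (8*k+6)
        rw [a1] at a2
        have : F (8*k+6) = F 0 := by simpa using hF 0
        rw [this] at a2
        exact (add_right_cancel a2).symm
      rw [hs]
      have : ∀ x : ZMod 2, x + x = 0 := by decide
      rw [this, zero_add, Finset.sum_const, Finset.card_range, nsmul_eq_mul, mul_one]
      rw [ZMod.natCast_eq_zero_iff]; omega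
    rw [ZMod.natCast_eq_zero_iff] at h1
    exact (even_iff_two_dvd).2 h1
  have hb2 : 2 ≤ Vb.card := by
    obtain ⟨x, hx, hx2, hx3⟩ := odd_cycle k 0 F hF
    obtain ⟨y, hy, hy2, hy3⟩ := odd_cycle k 1 F hF
    have : ({x, y} : Finset ℕ).card = 2 := Finset.card_pair (by rintro rfl; omega)
    rw [← this]
    apply Finset.card_le_card
    intro z hz
    simp only [Finset.mem_insert, Finset.mem_singleton] at hz
    simp only [hVb, Finset.mem_filter, Finset.mem_range]
    rcases hz with rfl | rfl
    · exact ⟨hx, hx3⟩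
    · exact ⟨hy, hy3⟩
  have hstep : ∀ j r, (∀ s < 2*r, F (j+s) ≠ F (j+s+1)) → F (j+2*r) = F j := by
    intro j r
    induction r with
    | zero => simp
    | succ r ih =>
      intro h
      have e0 := ih (fun s hs => h s (by omega))
      have e1 := h (2*r) (by omega)
      have e2 := h (2*r+1) (by omega)
      rw [show j + (2*r+1) = j + 2*r+1 by ring] at e2
      rw [show j + 2*(r+1) = j + 2*r+1+1 by ring]
      generalize F (j + 2*r+1+1) = y at *
      generalize F (j + 2*r+1) = z at *
      generalize F (j + 2*r) = u at *
      generalize F j = v at *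
      omega
  have hcov : 8*k+6 ≤ Vb.card + (2*k+2) * Va.card := by
    have hsub : (Finset.range (8*k+6)).filter (fun j => ¬ F j = F (j+(2*k+2))) ⊆
        (Finset.range (2*k+2)).biUnion (fun s => (Finset.range (8*k+6)).filter
          (fun j => F ((s + j) % (8*k+6)) = F ((s+j) % (8*k+6) + 1))) := by
      intro j hj
      simp only [Finset.mem_filter, Finset.mem_range] at hj
      simp only [Finset.mem_biUnion, Finset.mem_filter, Finset.mem_range]
      by_contra hc
      push Not at hc
      apply hj.2
      symm
      rw [show 2*k+2 = 2*(k+1) by ring]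
      apply hstep
      intro s hs
      have := hc s (by omega) hj.1
      rw [hmod, ← hmod ((s+j) % (8*k+6) + 1), Nat.mod_add_mod, hmod] at this
      rwa [add_comm j s]
    have h1 := Finset.card_le_card hsub
    have h2 := Finset.card_biUnion_le_card_mul (Finset.range (2*k+2)) (fun s => (Finset.range (8*k+6)).filter
          (fun j => F ((s + j) % (8*k+6)) = F ((s+j) % (8*k+6) + 1))) Va.card
          (fun s _ => cntShift (8*k+6) s (fun x => F x = F (x+1)))
    rw [Finset.card_range] at h2
    have h3 := Finset.card_filter_add_card_filter_not (s := Finset.range (8*k+6))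
      (fun j => F j = F (j+(2*k+2)))
    rw [Finset.card_range, ← hVb] at h3
    omega
  obtain ⟨c, hc⟩ := heven
  rw [hc] at hcov ⊢
  rcases c with _ | _ | c
  · simp at hcov; omega
  · simp at hcov ⊢; omega
  · nlinarith [Nat.zero_le (k*c)]

/-- vertex with index `x mod p` -/
def vx (k x : ℕ) : Fin (8*k+6) := ⟨x % (8*k+6), Nat.mod_lt _ (by omega)⟩

/-- the extremal weight -/
def wt (k : ℕ) (e : Sym2 (Fin (8*k+6))) : ℚ :=
  ∑ j ∈ Finset.range (8*k+6), (2*k*(if e = s(vx k j, vx k (j+1)) then 1 else 0) +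
    (if e = s(vx k j, vx k (j+(2*k+2))) then 1 else 0))

/-- the extremal graph -/
def Gx (k : ℕ) : SimpleGraph (Fin (8*k+6)) := SimpleGraph.fromEdgeSet {e | 0 < wt k e}

lemma wt_nonneg (k : ℕ) (e) : 0 ≤ wt k e := by
  unfold wt; exact Finset.sum_nonneg (fun j _ => by positivity)

lemma cw_Gx (k : ℕ) {β : Type} (H : SimpleGraph β) (f : Fin (8*k+6) → β) :
    cutWeight (Gx k) H (wt k) f = 2*k*(((Finset.range (8*k+6)).filter
      (fun j => H.Adj (f (vx k j)) (f (vx k (j+1))))).card : ℝ) +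
      (((Finset.range (8*k+6)).filter
      (fun j => H.Adj (f (vx k j)) (f (vx k (j+(2*k+2)))))).card : ℝ) := by
  have h1 : cutWeight (Gx k) H (wt k) f =
      ∑ e : Sym2 (Fin (8*k+6)), (if Sym2.map f e ∈ H.edgeSet then (1:ℝ) else 0) * (wt k e : ℝ) := by
    rw [cw_eq, Finset.sum_filter]
    apply Finset.sum_congr rfl
    intro e _
    by_cases he : e ∈ (Gx k).edgeSet
    · rw [if_pos he]
    · rw [if_neg he]
      simp only [Gx, SimpleGraph.edgeSet_fromEdgeSet, Set.mem_sdiff, Set.mem_ofPred_eq, not_and,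
        not_not] at he
      by_cases hz : 0 < wt k e
      · have hd := he hz
        have : ¬ Sym2.map f e ∈ H.edgeSet := by
          induction e using Sym2.ind with
          | _ a b =>
          simp at hd
          subst hd
          simp
        rw [if_neg this, zero_mul]
      · have : wt k e = 0 := le_antisymm (not_lt.1 hz) (wt_nonneg k e)
        rw [this]; simp
  rw [h1]
  unfold wt
  push_cast
  simp only [Finset.mul_sum]
  rw [Finset.sum_comm]
  rw [← Finset.sum_boole, ← Finset.sum_boole, Finset.mul_sum, ← Finset.sum_add_distrib]
  apply Finset.sum_congr rfl
  intro j _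
  simp only [mul_add, Finset.sum_add_distrib]
  congr 1
  · rw [Finset.sum_eq_single s(vx k j, vx k (j+1))]
    · simp; 
    · intro b _ hb; simp [hb]
    · simp
  · rw [Finset.sum_eq_single s(vx k j, vx k (j+(2*k+2)))]
    · simp
    · intro b _ hb; simp [hb]
    · simp

lemma circ_adj (k x d : ℕ) (hd : d = 4*k+1 ∨ d = 4*k+2) :
    (circK (8*k+6) (4*k+1)).Adj (vx k x) (vx k (x+d)) := by
  have hv : (vx k (x+d)).val = ((vx k x).val + d) % (8*k+6) := by
    simp [vx]
  have hlt := (vx k x).isLt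
  generalize vx k x = a at *
  generalize vx k (x+d) = b at *
  simp only [circK, SimpleGraph.fromRel_adj, ne_eq, Fin.ext_iff]
  rcases modcase a.val d (8*k+6) hlt (by omega) with h | h <;> omega

lemma mcN (k : ℕ) : (8*k+6) * (2*k+1) ≤ mcMax (circK (8*k+6) (4*k+1)) (Gx k) (wt k) := by
  have h := cw_le_mc (Gx k) (circK (8*k+6) (4*k+1)) (wt k) (fun i => vx k ((4*k+1)*i.val))
  rw [cw_Gx] at h
  have e : ∀ j d, vx k ((4*k+1)*(vx k (j+d)).val) = vx k ((4*k+1)*j + (4*k+1)*d) := by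
    intro j d
    simp only [vx, Fin.mk.injEq]
    rw [← mul_add]
    exact (Nat.mod_modEq _ _).mul_left _
  have e0 : ∀ j, vx k ((4*k+1)*(vx k j).val) = vx k ((4*k+1)*j) := fun j => e j 0
  have e2 : ∀ x, vx k (x + (4*k+1)*(2*k+2)) = vx k (x + (4*k+2)) := by
    intro x
    simp only [vx, Fin.mk.injEq]
    rw [show x + (4*k+1)*(2*k+2) = x + (4*k+2) + (8*k+6)*k by ring, Nat.add_mul_mod_self_left]
  rw [Finset.filter_true_of_mem, Finset.filter_true_of_mem] at h
  · rw [Finset.card_range] at h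
    refine le_trans (le_of_eq ?_) h
    push_cast; ring
  · intro j _
    rw [e0, e, e2]
    exact circ_adj k _ _ (Or.inr rfl)
  · intro j _
    rw [e0, e, mul_one]
    exact circ_adj k _ _ (Or.inl rfl)

lemma mcK2 (k : ℕ) : mcMax K2 (Gx k) (wt k) ≤ 16*(k:ℝ)^2+12*k+4 := by
  apply ciSup_le
  intro f
  rw [cw_Gx]
  have hc := comb k (fun j => f (vx k j)) (by intro j; simp [vx])
  simp only [K2, SimpleGraph.top_adj, ne_eq]
  have h1 := Finset.card_filter_add_card_filter_not (s := Finset.range (8*k+6))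
    (fun j => f (vx k j) = f (vx k (j+1)))
  have h2 := Finset.card_filter_add_card_filter_not (s := Finset.range (8*k+6))
    (fun j => f (vx k j) = f (vx k (j+(2*k+2))))
  rw [Finset.card_range] at h1 h2
  have h1' := congrArg (Nat.cast (R := ℝ)) h1
  have h2' := congrArg (Nat.cast (R := ℝ)) h2
  have hc' := (Nat.cast_le (α := ℝ)).2 hc
  push_cast at h1' h2' hc'
  have h3 := congrArg (fun x => 2*(k:ℝ)*x) h1'
  nlinarith

lemma mc_nonneg {n m : ℕ} [NeZero m] (H : SimpleGraph (Fin m)) (G : SimpleGraph (Fin n))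
    (w : Sym2 (Fin n) → ℚ) (hw : ∀ e ∈ G.edgeSet, 0 < w e) : 0 ≤ mcMax H G w := by
  refine le_trans ?_ (cw_le_mc G H w (fun _ => 0))
  apply Finset.sum_nonneg
  intro e he
  simp only [Finset.mem_filter] at he
  exact_mod_cast (hw e he.2.1).le

lemma mc_pos (k : ℕ) (n : ℕ) (G : SimpleGraph (Fin n)) (w : Sym2 (Fin n) → ℚ)
    (hne : G.edgeSet.Nonempty) (hw : ∀ e ∈ G.edgeSet, 0 < w e) :
    0 < mcMax (circK (8*k+6) (4*k+1)) G w := by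
  obtain ⟨e, he⟩ := hne
  induction e using Sym2.ind with
  | _ a b =>
  have hab : a ≠ b := ((SimpleGraph.mem_edgeSet G).1 he).ne
  refine lt_of_lt_of_le ?_ (cw_le_mc G _ w
    (fun x => if x = a then vx k 0 else vx k (0 + (4*k+1))))
  apply Finset.sum_pos'
  · intro e he
    simp only [Finset.mem_filter] at he
    exact_mod_cast (hw e he.2.1).le
  · refine ⟨s(a, b), ?_, by exact_mod_cast hw _ he⟩
    simp only [Finset.mem_filter, Finset.mem_univ, true_and, Sym2.map_mk, SimpleGraph.mem_edgeSet]
    refine ⟨he, ?_⟩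
    simp only [if_true, if_neg hab.symm]
    exact circ_adj k 0 _ (Or.inl rfl)

theorem stmt3 (k : ℕ) (hk : 1 ≤ k) :
    sVal K2 (circK (8*k+6) (4*k+1)) = (8*(k:ℝ)^2+6*(k:ℝ)+2) / (8*(k:ℝ)^2+10*(k:ℝ)+3) := by
  have hS : (0:ℝ) < 16*(k:ℝ)^2+12*k+4 := by positivity
  have hP : (0:ℝ) < (8*(k:ℝ)+6) * (2*k+1) := by positivity
  have hval : (8*(k:ℝ)^2+6*(k:ℝ)+2) / (8*(k:ℝ)^2+10*(k:ℝ)+3) =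
      (16*(k:ℝ)^2+12*k+4) / ((8*(k:ℝ)+6) * (2*k+1)) := by
    rw [div_eq_div_iff (by positivity) hP.ne']; ring
  have hlow : ∀ (n : ℕ) (G : SimpleGraph (Fin n)) (w : Sym2 (Fin n) → ℚ),
      G.edgeSet.Nonempty → (∀ e ∈ G.edgeSet, 0 < w e) →
      (16*(k:ℝ)^2+12*k+4) / ((8*(k:ℝ)+6) * (2*k+1)) ≤
        mcMax K2 G w / mcMax (circK (8*k+6) (4*k+1)) G w := by
    intro n G w hne hw
    have hpos := mc_pos k n G w hne hw
    rw [div_le_div_iff₀ hP hpos]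
    have h1 : mcMax (circK (8*k+6) (4*k+1)) G w ≤
        (8*k+6) * (2*k+1) * mcMax K2 G w / (16*(k:ℝ)^2+12*k+4) := by
      apply ciSup_le
      intro f
      rw [le_div_iff₀ hS, mul_comm]
      exact lower k hk n G w hw f
    rw [le_div_iff₀ hS] at h1
    linarith
  have hGw : ∀ e ∈ (Gx k).edgeSet, 0 < wt k e := by
    intro e he
    simp only [Gx, SimpleGraph.edgeSet_fromEdgeSet] at he
    exact he.1
  have hGne : (Gx k).edgeSet.Nonempty := by
    by_contra hcon
    rw [Set.not_nonempty_iff_eq_empty] at hcon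
    have h1 := mcN k
    have h2 : mcMax (circK (8*k+6) (4*k+1)) (Gx k) (wt k) ≤ 0 := by
      apply ciSup_le
      intro f
      unfold cutWeight
      apply le_of_eq
      apply Finset.sum_eq_zero
      intro e he
      simp [hcon] at he
    linarith
  have hmem : mcMax K2 (Gx k) (wt k) / mcMax (circK (8*k+6) (4*k+1)) (Gx k) (wt k) ∈
      { x : ℝ | ∃ (n : ℕ) (G : SimpleGraph (Fin n)) (w : Sym2 (Fin n) → ℚ),
        G.edgeSet.Nonempty ∧ (∀ e ∈ G.edgeSet, 0 < w e) ∧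
        x = mcMax K2 G w / mcMax (circK (8*k+6) (4*k+1)) G w } :=
    ⟨_, Gx k, wt k, hGne, hGw, rfl⟩
  rw [hval]
  apply le_antisymm
  · refine le_trans (csInf_le ⟨(16*(k:ℝ)^2+12*k+4) / ((8*(k:ℝ)+6) * (2*k+1)), ?_⟩ hmem) ?_
    · rintro x ⟨n, G, w, hne, hw, rfl⟩
      exact hlow n G w hne hw
    · exact div_le_div₀ hS.le (mcK2 k) hP (mcN k)
  · refine le_csInf ⟨_, hmem⟩ ?_
    rintro x ⟨n, G, w, hne, hw, rfl⟩
    exact hlow n G w hne hw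
end
end
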